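/- arXiv:2301.04759 — 2 statements merged into one kernel-verified Lean document; each statement's English description precedes it below -/
import Mathlib

section
/- For each d ≥ 1 there exists a polynomial Π_d in the d variables (s, a_1, …, a_{d−1}) with rational coefficients such that Π_d(s, 0, …, 0) = 0 and, for all a_1, …, a_{d−1} ∈ ℂ and all s ∈ ℂ ∖ {−1, −2, …}, the determinant Δ(s | a_1, …, a_{d−1}) of the d×d matrix with entries F_{k−1}(s+l | a_1, …, a_{d−1}) satisfies Δ(s | a_1, …, a_{d−1}) = Δ(s | 0, …, 0) · exp( Π_d(s, a_1, …, a_{d−1}) ). -/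
/-- The polynomial `P₀(t) = -t^d/d + ∑_{k=1}^{d-1} a_k t^k`. -/
noncomputable def P0 (d : ℕ) (a : ℕ → ℂ) (t : ℂ) : ℂ :=
  -t ^ d / (d : ℂ) + ∑ k ∈ Finset.Ico 1 d, a k * t ^ k

/-- The Omega function `Ω_k(s) = e^{2πiks/d} ∫_0^∞ u^{s-1} e^{P₀(ω_k u)} du`, for `Re s > 0`,
where `ω_k = e^{2πik/d}` and `u^{s-1} = exp((s-1) log u)` for real `u > 0`. -/
noncomputable def OmegaFn (d : ℕ) (a : ℕ → ℂ) (k : ℕ) (s : ℂ) : ℂ :=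
  Complex.exp (2 * Real.pi * Complex.I * k * s / d) *
    ∫ u in Set.Ioi (0 : ℝ),
      (u : ℂ) ^ (s - 1) *
        Complex.exp (P0 d a (Complex.exp (2 * Real.pi * Complex.I * k / d) * u))

open MeasureTheory Set Filter Topology

lemma exists_mul_pow_le {d j : ℕ} (hj : j < d) (c : ℝ) {ε : ℝ} (hε : 0 < ε) :
    ∃ K : ℝ, ∀ u : ℝ, 0 ≤ u → c * u ^ j ≤ ε * u ^ d + K := by
  set M : ℝ := max 1 (|c| / ε)
  have hM : 1 ≤ M := le_max_left _ _
  refine ⟨|c| * M ^ j, fun u hu => ?_⟩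
  have h1 : c * u ^ j ≤ |c| * u ^ j := by gcongr; exact le_abs_self c
  rcases le_total u M with h | h
  · have : |c| * u ^ j ≤ |c| * M ^ j := by gcongr
    have : 0 ≤ ε * u ^ d := by positivity
    linarith
  · have hc : |c| ≤ ε * u := by
      have : |c| / ε ≤ u := (le_max_right _ _).trans h
      rwa [div_le_iff₀' hε] at this
    have h2 : |c| * u ^ j ≤ ε * u ^ d := by
      calc |c| * u ^ j ≤ ε * u * u ^ j := by gcongr
        _ = ε * u ^ (j + 1) := by ring
        _ ≤ ε * u ^ d := by
          gcongr
          · exact hM.trans h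
          · exact hj
    have : 0 ≤ |c| * M ^ j := by positivity
    linarith

lemma exists_sum_mul_pow_le {d : ℕ} (c : ℕ → ℝ) (S : Finset ℕ) (hS : ∀ j ∈ S, j < d) :
    ∀ ε : ℝ, 0 < ε → ∃ K : ℝ, ∀ u : ℝ, 0 ≤ u →
      ∑ j ∈ S, c j * u ^ j ≤ ε * u ^ d + K := by
  induction S using Finset.induction_on with
  | empty =>
    intro ε hε
    exact ⟨0, fun u hu => by simp; positivity⟩
  | insert j S hj ih =>
    intro ε hε
    obtain ⟨K, hK⟩ := ih (fun i hi => hS i (Finset.mem_insert_of_mem hi)) (ε / 2) (by positivity)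
    obtain ⟨L, hL⟩ := exists_mul_pow_le (hS j (Finset.mem_insert_self _ _)) (c j)
      (ε := ε / 2) (by positivity)
    refine ⟨K + L, fun u hu => ?_⟩
    rw [Finset.sum_insert hj]
    linarith [hK u hu, hL u hu]

lemma integrableOn_rpow_mul_pow_mul_exp {d : ℕ} (hd : 1 ≤ d) (c : ℕ → ℝ) {σ : ℝ} (hσ : 0 < σ)
    (j : ℕ) :
    IntegrableOn (fun u : ℝ => u ^ (σ - 1) * u ^ j *
      Real.exp (-u ^ d / d + ∑ k ∈ Finset.Ico 1 d, c k * u ^ k)) (Ioi 0) := by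
  have hd0 : (0 : ℝ) < d := by exact_mod_cast hd
  obtain ⟨K, hK⟩ := exists_sum_mul_pow_le c (Finset.Ico 1 d)
    (fun j hj => (Finset.mem_Ico.1 hj).2) (1 / (2 * d)) (by positivity)
  have hj : (0 : ℝ) ≤ j := by positivity
  have h := (integrableOn_rpow_mul_exp_neg_mul_rpow (p := d) (s := σ - 1 + j) (b := 1 / (2 * d))
    (by linarith) hd0 (by positivity)).const_mul (Real.exp K)
  refine Integrable.mono' h ?_ ?_
  · refine (ContinuousOn.mul (ContinuousOn.mul ?_ (by fun_prop)) (by fun_prop)).aestronglyMeasurable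
      measurableSet_Ioi
    exact fun u hu => (Real.continuousAt_rpow_const _ _ (Or.inl (ne_of_gt hu))).continuousWithinAt
  · refine (ae_restrict_iff' measurableSet_Ioi).2 (ae_of_all _ fun u hu => ?_)
    have hu : 0 < u := hu
    rw [Real.norm_of_nonneg (by positivity), Real.rpow_add hu, Real.rpow_natCast,
      Real.rpow_natCast, mul_left_comm, ← Real.exp_add]
    refine mul_le_mul_of_nonneg_left (Real.exp_le_exp.2 ?_) (by positivity)
    have := hK u hu.le
    have e : -u ^ d / d = -(1 / (2 * d) * u ^ d) - 1 / (2 * d) * u ^ d := by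
      field_simp; ring
    rw [e]
    linarith

lemma norm_exp_P0_le {d : ℕ} (hd : 1 ≤ d) (a : ℕ → ℂ) {w : ℂ} (hw : w ^ d = 1) {c : ℕ → ℝ}
    (hc : ∀ k, ‖a k‖ ≤ c k) {u : ℝ} (hu : 0 ≤ u) :
    ‖Complex.exp (P0 d a (w * u))‖ ≤
      Real.exp (-u ^ d / d + ∑ k ∈ Finset.Ico 1 d, c k * u ^ k) := by
  have hw1 : ‖w‖ = 1 := Complex.norm_eq_one_of_pow_eq_one hw (by omega)
  rw [Complex.norm_exp]
  gcongr
  rw [P0, Complex.add_re, mul_pow, hw, one_mul]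
  refine add_le_add (le_of_eq ?_) ?_
  · norm_cast
  · refine (Complex.re_le_norm _).trans ((norm_sum_le _ _).trans (Finset.sum_le_sum fun k _ => ?_))
    rw [norm_mul, norm_pow, norm_mul, hw1, one_mul, Complex.norm_real, Real.norm_of_nonneg hu]
    gcongr
    exact hc k

lemma continuousOn_ofReal_cpow (s : ℂ) : ContinuousOn (fun u : ℝ => (u : ℂ) ^ s) (Ioi 0) :=
  fun u hu => (Complex.continuousAt_ofReal_cpow_const u s
    (Or.inr (ne_of_gt hu))).continuousWithinAt

lemma continuous_P0 (d : ℕ) (a : ℕ → ℂ) : Continuous (P0 d a) := by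
  unfold P0; fun_prop

lemma integrableOn_cpow_mul_pow_mul_exp {d : ℕ} (hd : 1 ≤ d) (a : ℕ → ℂ) {w : ℂ} (hw : w ^ d = 1)
    {s : ℂ} (hs : 0 < s.re) (j : ℕ) :
    IntegrableOn (fun u : ℝ => (u : ℂ) ^ (s - 1) * (w * u) ^ j *
      Complex.exp (P0 d a (w * u))) (Ioi 0) := by
  have hw1 : ‖w‖ = 1 := Complex.norm_eq_one_of_pow_eq_one hw (by omega)
  refine Integrable.mono' (integrableOn_rpow_mul_pow_mul_exp hd (fun k => ‖a k‖) hs j) ?_ ?_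
  · have := continuous_P0 d a
    refine (ContinuousOn.mul (ContinuousOn.mul (continuousOn_ofReal_cpow _) (by fun_prop))
      (by fun_prop)).aestronglyMeasurable measurableSet_Ioi
  · refine (ae_restrict_iff' measurableSet_Ioi).2 (ae_of_all _ fun u hu => ?_)
    have hu : 0 < u := hu
    rw [norm_mul, norm_mul, norm_pow, norm_mul, hw1, one_mul,
      Complex.norm_cpow_eq_rpow_re_of_pos hu, Complex.norm_real, Real.norm_of_nonneg hu.le,
      Complex.sub_re, Complex.one_re]
    gcongr
    exact norm_exp_P0_le hd a hw (fun _ => le_rfl) hu.le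

lemma exp_pow_eq_one {d : ℕ} (hd : 1 ≤ d) (k : ℕ) :
    Complex.exp (2 * Real.pi * Complex.I * k / d) ^ d = 1 := by
  have hd0 : (d : ℂ) ≠ 0 := by exact_mod_cast (by omega : d ≠ 0)
  rw [← Complex.exp_nat_mul, mul_div_cancel₀ _ hd0, mul_comm]
  exact Complex.exp_nat_mul_two_pi_mul_I k

lemma OmegaFn_add_natCast (d : ℕ) (a : ℕ → ℂ) (k : ℕ) (s : ℂ) (j : ℕ) :
    OmegaFn d a k (s + j) = Complex.exp (2 * Real.pi * Complex.I * k * s / d) *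
      ∫ u in Ioi (0 : ℝ), (u : ℂ) ^ (s - 1) *
        (Complex.exp (2 * Real.pi * Complex.I * k / d) * u) ^ j *
        Complex.exp (P0 d a (Complex.exp (2 * Real.pi * Complex.I * k / d) * u)) := by
  rw [OmegaFn, ← integral_const_mul, ← integral_const_mul]
  refine setIntegral_congr_fun measurableSet_Ioi fun u hu => ?_
  have hu0 : (u : ℂ) ≠ 0 := by exact_mod_cast (ne_of_gt hu)
  have e1 : Complex.exp (2 * Real.pi * Complex.I * k * (s + j) / d) =
      Complex.exp (2 * Real.pi * Complex.I * k * s / d) *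
        Complex.exp (2 * Real.pi * Complex.I * k / d) ^ j := by
    rw [← Complex.exp_nat_mul, ← Complex.exp_add]
    congr 1; ring
  have e2 : (u : ℂ) ^ (s + j - 1) = (u : ℂ) ^ (s - 1) * (u : ℂ) ^ j := by
    rw [← Complex.cpow_natCast, ← Complex.cpow_add _ _ hu0]
    congr 1; ring
  simp only [e1, e2, mul_pow]
  ring

lemma hasDerivAt_P0 {d : ℕ} (hd : 1 ≤ d) (a : ℕ → ℂ) (w : ℂ) (u : ℝ) (hu : u ≠ 0) :
    HasDerivAt (fun u : ℝ => P0 d a (w * u))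
      ((u : ℂ)⁻¹ * (-(w * u) ^ d + ∑ j ∈ Finset.Ico 1 d, j * a j * (w * u) ^ j)) u := by
  have hd0 : (d : ℂ) ≠ 0 := by exact_mod_cast (by omega : d ≠ 0)
  have hu0 : (u : ℂ) ≠ 0 := by exact_mod_cast hu
  have hlin : HasDerivAt (fun u : ℝ => w * (u : ℂ)) w u := by
    simpa using (Complex.ofRealCLM.hasDerivAt (x := u)).const_mul w
  have hpow : ∀ n : ℕ, HasDerivAt (fun u : ℝ => (w * (u : ℂ)) ^ n)
      ((u : ℂ)⁻¹ * (n * (w * u) ^ n)) u := by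
    intro n
    refine (hlin.pow n).congr_deriv ?_
    rcases n with _ | n
    · simp
    · rw [pow_succ (w * (u : ℂ)) n]
      simp only [Nat.add_sub_cancel]
      field_simp
  refine HasDerivAt.congr_deriv (((hpow d).neg.div_const (d : ℂ)).add
    (HasDerivAt.fun_sum (u := Finset.Ico 1 d) fun j _ => (hpow j).const_mul (a j))) ?_
  rw [mul_add, Finset.mul_sum]
  congr 1
  · field_simp
  · exact Finset.sum_congr rfl fun j _ => by ring

lemma OmegaFn_add_degree {d : ℕ} (hd : 1 ≤ d) (a : ℕ → ℂ) (k : ℕ) {s : ℂ} (hs : 0 < s.re) :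
    OmegaFn d a k (s + d) = s * OmegaFn d a k s +
      ∑ j ∈ Finset.Ico 1 d, j * a j * OmegaFn d a k (s + j) := by
  set w := Complex.exp (2 * Real.pi * Complex.I * k / d) with hwdef
  have hw : w ^ d = 1 := exp_pow_eq_one hd k
  have hs0 : s ≠ 0 := by rintro rfl; simp at hs
  have hint := fun j => integrableOn_cpow_mul_pow_mul_exp hd a hw hs j
  set f : ℕ → ℝ → ℂ := fun j u => (u : ℂ) ^ (s - 1) * (w * u) ^ j *
      Complex.exp (P0 d a (w * u)) with hf
  have hΩ : ∀ j : ℕ, OmegaFn d a k (s + j) = Complex.exp (2 * Real.pi * Complex.I * k * s / d) *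
      ∫ u in Ioi (0 : ℝ), f j u := OmegaFn_add_natCast d a k s
  set G : ℝ → ℂ := fun u => (u : ℂ) ^ s * Complex.exp (P0 d a (w * u)) with hG
  set g : ℝ → ℂ := fun u => s * f 0 u - f d u + ∑ j ∈ Finset.Ico 1 d, j * a j * f j u with hg
  have hsum : IntegrableOn (fun u => ∑ j ∈ Finset.Ico 1 d, j * a j * f j u) (Ioi 0) :=
    integrable_finsetSum _ fun j _ => (hint j).const_mul _
  have hdiff : IntegrableOn (fun u => s * f 0 u - f d u) (Ioi 0) :=
    ((hint 0).const_mul s).sub (hint d)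
  have hgint : IntegrableOn g (Ioi 0) := hdiff.add hsum
  have hGint : IntegrableOn G (Ioi 0) := by
    have h1 : 0 < (s + 1).re := by simp; linarith
    refine (integrableOn_cpow_mul_pow_mul_exp hd a hw h1 0).congr_fun (fun u _ => ?_)
      measurableSet_Ioi
    simp [hG]
  have hderiv : ∀ u ∈ Ioi (0 : ℝ), HasDerivAt G (g u) u := by
    intro u hu
    have hu' : u ≠ 0 := ne_of_gt hu
    have hu0 : (u : ℂ) ≠ 0 := by exact_mod_cast hu'
    refine ((hasDerivAt_ofReal_cpow_const hu' hs0).mul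
      (hasDerivAt_P0 hd a w u hu').cexp).congr_deriv ?_
    have e : (u : ℂ) ^ s = (u : ℂ) ^ (s - 1) * u := by
      rw [Complex.cpow_sub _ _ hu0, Complex.cpow_one]; field_simp
    simp only [hg, hf, e]
    have e2 : ∑ j ∈ Finset.Ico 1 d, (j : ℂ) * a j *
        ((u : ℂ) ^ (s - 1) * (w * u) ^ j * Complex.exp (P0 d a (w * u))) =
        (u : ℂ) ^ (s - 1) * Complex.exp (P0 d a (w * u)) *
          ∑ j ∈ Finset.Ico 1 d, j * a j * (w * u) ^ j := by
      rw [Finset.mul_sum]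
      exact Finset.sum_congr rfl fun j _ => by ring
    rw [e2]
    field_simp
    ring
  have hcont : ContinuousWithinAt G (Ici 0) 0 := by
    have := continuous_P0 d a
    have h2 := Complex.continuous_ofReal_cpow_const hs
    have : Continuous G := by fun_prop
    exact this.continuousWithinAt
  have key := integral_Ioi_of_hasDerivAt_of_tendsto hcont hderiv hgint
    (tendsto_zero_of_hasDerivAt_of_integrableOn_Ioi hderiv hgint hGint)
  have hG0 : G 0 = 0 := by simp [hG, hs0]
  rw [hG0, sub_zero] at key
  have expand : ∫ u in Ioi 0, g u = s * (∫ u in Ioi 0, f 0 u) - (∫ u in Ioi 0, f d u) +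
      ∑ j ∈ Finset.Ico 1 d, j * a j * ∫ u in Ioi 0, f j u := by
    rw [hg, integral_add hdiff hsum, integral_sub ((hint 0).const_mul s) (hint d),
      integral_const_mul, integral_finsetSum _ fun j _ => (hint j).const_mul _]
    simp only [integral_const_mul, hf]
  rw [expand] at key
  have hΩ0 := hΩ 0
  rw [Nat.cast_zero, add_zero] at hΩ0
  rw [hΩ0, hΩ d]
  simp only [hΩ]
  have e3 : ∑ j ∈ Finset.Ico 1 d, (j : ℂ) * a j *
      (Complex.exp (2 * Real.pi * Complex.I * k * s / d) * ∫ u in Ioi 0, f j u) =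
      Complex.exp (2 * Real.pi * Complex.I * k * s / d) *
        ∑ j ∈ Finset.Ico 1 d, j * a j * ∫ u in Ioi 0, f j u := by
    rw [Finset.mul_sum]
    exact Finset.sum_congr rfl fun j _ => by ring
  rw [e3]
  linear_combination (-Complex.exp (2 * Real.pi * Complex.I * k * s / d)) * key

lemma P0_smul (d : ℕ) (a : ℕ → ℂ) (x t : ℂ) :
    P0 d (fun n => x * a n) t = -t ^ d / d + x * ∑ j ∈ Finset.Ico 1 d, a j * t ^ j := by
  rw [P0, Finset.mul_sum]
  simp only [mul_assoc]

lemma hasDerivAt_OmegaFn_smul {d : ℕ} (hd : 1 ≤ d) (a : ℕ → ℂ) (k : ℕ) {s : ℂ} (hs : 0 < s.re)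
    (x : ℂ) :
    HasDerivAt (fun x : ℂ => OmegaFn d (fun n => x * a n) k s)
      (∑ j ∈ Finset.Ico 1 d, a j * OmegaFn d (fun n => x * a n) k (s + j)) x := by
  set w := Complex.exp (2 * Real.pi * Complex.I * k / d) with hwdef
  have hw : w ^ d = 1 := exp_pow_eq_one hd k
  have hw1 : ‖w‖ = 1 := Complex.norm_eq_one_of_pow_eq_one hw (by omega)
  have hint := fun (x : ℂ) j => integrableOn_cpow_mul_pow_mul_exp hd (fun n => x * a n) hw hs j
  set F : ℂ → ℝ → ℂ := fun x u => (u : ℂ) ^ (s - 1) *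
      Complex.exp (P0 d (fun n => x * a n) (w * u)) with hF
  set F' : ℂ → ℝ → ℂ := fun x u => ∑ j ∈ Finset.Ico 1 d, a j * ((u : ℂ) ^ (s - 1) * (w * u) ^ j *
      Complex.exp (P0 d (fun n => x * a n) (w * u))) with hF'
  have hFint : ∀ x, IntegrableOn (F x) (Ioi 0) := fun x => by simpa [hF] using hint x 0
  have hF'int : ∀ x, IntegrableOn (F' x) (Ioi 0) := fun x =>
    integrable_finsetSum _ fun j _ => (hint x j).const_mul (a j)
  set c : ℕ → ℝ := fun n => (‖x‖ + 1) * ‖a n‖ with hc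
  have hder := (hasDerivAt_integral_of_dominated_loc_of_deriv_le (μ := volume.restrict (Ioi 0))
    (F := F) (F' := F') (x₀ := x) (s := Metric.ball x 1)
    (bound := fun u => ∑ j ∈ Finset.Ico 1 d, ‖a j‖ * (u ^ (s.re - 1) * u ^ j *
      Real.exp (-u ^ d / d + ∑ k ∈ Finset.Ico 1 d, c k * u ^ k)))
    (Metric.ball_mem_nhds x one_pos) (Eventually.of_forall fun y => (hFint y).aestronglyMeasurable)
    (hFint x) (hF'int x).aestronglyMeasurable ?_
    (integrable_finsetSum _ fun j _ =>
      (integrableOn_rpow_mul_pow_mul_exp hd c hs j).const_mul ‖a j‖) ?_).2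
  · refine (hder.const_mul (Complex.exp (2 * Real.pi * Complex.I * k * s / d))).congr_deriv ?_
    rw [hF', integral_finsetSum _ fun j _ => (hint x j).const_mul _, Finset.mul_sum]
    refine Finset.sum_congr rfl fun j _ => ?_
    rw [OmegaFn_add_natCast, integral_const_mul]
    ring
  · refine (ae_restrict_iff' measurableSet_Ioi).2 (ae_of_all _ fun u hu y hy => ?_)
    have hu : 0 < u := hu
    refine (norm_sum_le _ _).trans (Finset.sum_le_sum fun j _ => ?_)
    rw [norm_mul, norm_mul, norm_mul, norm_pow, norm_mul, hw1, one_mul,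
      Complex.norm_cpow_eq_rpow_re_of_pos hu, Complex.norm_real, Real.norm_of_nonneg hu.le,
      Complex.sub_re, Complex.one_re]
    gcongr
    refine norm_exp_P0_le hd _ hw (fun n => ?_) hu.le
    rw [norm_mul]
    have : ‖y‖ ≤ ‖x‖ + 1 := by
      have := norm_le_norm_add_norm_sub x y
      rw [Metric.mem_ball, dist_comm, dist_eq_norm] at hy
      linarith
    simp only [hc]
    gcongr
  · refine (ae_of_all _ fun u y _ => ?_)
    simp only [hF, hF', P0_smul]
    refine (((((hasDerivAt_id y).mul_const (∑ j ∈ Finset.Ico 1 d, a j * (w * u) ^ j)).const_add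
      (-(w * (u : ℂ)) ^ d / d)).cexp).const_mul ((u : ℂ) ^ (s - 1))).congr_deriv ?_
    rw [one_mul, Finset.mul_sum, Finset.mul_sum]
    refine Finset.sum_congr rfl fun j _ => ?_
    simp only [id]
    ring

/-- The point `(s, a_1, …, a_{d-1})` at which polynomials in `d` variables are evaluated. -/
def evalPoint (d : ℕ) (s : ℂ) (a : ℕ → ℂ) : Fin d → ℂ :=
  fun i => if (i : ℕ) = 0 then s else a i

lemma evalPoint_smul_prod {d : ℕ} (s : ℂ) (a : ℕ → ℂ) (m : Fin d →₀ ℕ) (x : ℂ) :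
    (m.prod fun i n => evalPoint d s (fun n => x * a n) i ^ n) =
      x ^ (∑ i : Fin d, if (i : ℕ) = 0 then 0 else m i) *
        m.prod fun i n => evalPoint d s a i ^ n := by
  rw [Finsupp.prod_fintype _ _ (by simp), Finsupp.prod_fintype _ _ (by simp),
    ← Finset.prod_pow_eq_pow_sum, ← Finset.prod_mul_distrib]
  refine Finset.prod_congr rfl fun i _ => ?_
  by_cases h : (i : ℕ) = 0 <;> simp [evalPoint, h, mul_pow]

lemma exists_radial_antiderivative {d j : ℕ} (hj1 : 1 ≤ j) (hjd : j < d)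
    (T : MvPolynomial (Fin d) ℚ) :
    ∃ Q : MvPolynomial (Fin d) ℚ,
      (∀ s, MvPolynomial.aeval (evalPoint d s fun _ => 0) Q = 0) ∧
      ∀ (s : ℂ) (a : ℕ → ℂ) (x : ℂ), HasDerivAt
        (fun x : ℂ => MvPolynomial.aeval (evalPoint d s fun n => x * a n) Q)
        (a j * MvPolynomial.aeval (evalPoint d s fun n => x * a n) T) x := by
  induction T using MvPolynomial.induction_on' with
  | monomial m r =>
    set N := ∑ i : Fin d, if (i : ℕ) = 0 then 0 else m i with hN
    have hj0 : j ≠ 0 := by omega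
    refine ⟨MvPolynomial.monomial m (r / (N + 1)) * MvPolynomial.X ⟨j, hjd⟩, fun s => ?_,
      fun s a x => ?_⟩
    · simp [evalPoint, hj0]
    · have hN0 : (N : ℂ) + 1 ≠ 0 := by exact_mod_cast Nat.succ_ne_zero N
      set A := m.prod fun i n => evalPoint d s a i ^ n with hA
      have e1 : (fun x : ℂ => MvPolynomial.aeval (evalPoint d s fun n => x * a n)
          (MvPolynomial.monomial m (r / (N + 1)) * MvPolynomial.X ⟨j, hjd⟩)) =
          fun x => (r / (N + 1) * A * a j) * x ^ (N + 1) := by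
        funext y
        rw [map_mul, MvPolynomial.aeval_monomial, evalPoint_smul_prod, ← hN, ← hA,
          MvPolynomial.aeval_X]
        simp only [evalPoint, hj0, if_false, eq_ratCast]
        push_cast
        ring
      rw [e1, MvPolynomial.aeval_monomial, evalPoint_smul_prod, ← hN, ← hA]
      refine ((hasDerivAt_pow (N + 1) x).const_mul _).congr_deriv ?_
      simp only [eq_ratCast, Nat.add_sub_cancel]
      push_cast
      field_simp
  | add p q hp hq =>
    obtain ⟨P, hP0, hP⟩ := hp
    obtain ⟨Q, hQ0, hQ⟩ := hq
    refine ⟨P + Q, fun s => by rw [map_add, hP0, hQ0, add_zero], fun s a x => ?_⟩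
    simp only [map_add, mul_add]
    exact (hP s a x).add (hQ s a x)

lemma exists_reduction {d : ℕ} (hd : 1 ≤ d) (m : ℕ) :
    ∃ c : Fin d → MvPolynomial (Fin d) ℚ, ∀ (f : ℂ → ℂ) (a : ℕ → ℂ) (s : ℂ),
      (∀ z : ℂ, 0 < z.re →
        f (z + d) = z * f z + ∑ j ∈ Finset.Ico 1 d, j * a j * f (z + j)) → 0 < s.re →
      f (s + m + 1) =
        ∑ l : Fin d, MvPolynomial.aeval (evalPoint d s a) (c l) * f (s + (l : ℕ) + 1) := by
  induction m using Nat.strong_induction_on with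
  | _ m ih =>
    rcases lt_or_ge m d with hm | hm
    · refine ⟨Pi.single ⟨m, hm⟩ 1, fun f a s _ _ => ?_⟩
      rw [Finset.sum_eq_single ⟨m, hm⟩]
      · simp
      · intro l _ hl
        simp [Pi.single_eq_of_ne hl]
      · simp
    · obtain ⟨n, rfl⟩ := Nat.exists_eq_add_of_le' hm
      have ih' : ∀ m' : ℕ, ∃ c : Fin d → MvPolynomial (Fin d) ℚ, m' < n + d →
          ∀ (f : ℂ → ℂ) (a : ℕ → ℂ) (s : ℂ),
          (∀ z : ℂ, 0 < z.re →
            f (z + d) = z * f z + ∑ j ∈ Finset.Ico 1 d, j * a j * f (z + j)) → 0 < s.re →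
          f (s + m' + 1) = ∑ l : Fin d,
            MvPolynomial.aeval (evalPoint d s a) (c l) * f (s + (l : ℕ) + 1) := by
        intro m'
        by_cases h : m' < n + d
        · obtain ⟨c, hc⟩ := ih m' h
          exact ⟨c, fun _ => hc⟩
        · exact ⟨0, fun h' => absurd h' h⟩
      choose c hc using ih'
      let v : ℕ → MvPolynomial (Fin d) ℚ := fun j => if h : j < d then MvPolynomial.X ⟨j, h⟩ else 0
      refine ⟨fun l => (v 0 + n + 1) * c n l +
        ∑ j ∈ Finset.Ico 1 d, (j : MvPolynomial (Fin d) ℚ) * v j * c (n + j) l,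
        fun f a s hf hs => ?_⟩
      have hv0 : MvPolynomial.aeval (evalPoint d s a) (v 0) = s := by
        have : 0 < d := hd
        simp [v, this, evalPoint]
      have hv : ∀ j ∈ Finset.Ico 1 d, MvPolynomial.aeval (evalPoint d s a) (v j) = a j := by
        intro j hj
        obtain ⟨h1, h2⟩ := Finset.mem_Ico.1 hj
        have h3 : j ≠ 0 := by omega
        simp [v, h2, h3, evalPoint]
      have hz : 0 < (s + n + 1).re := by
        simp only [Complex.add_re, Complex.natCast_re, Complex.one_re]
        positivity
      have e1 : s + ((n + d : ℕ) : ℂ) + 1 = s + n + 1 + d := by push_cast; ring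
      have e2 : ∀ j ∈ Finset.Ico 1 d, (j : ℂ) * a j * f (s + n + 1 + j) =
          ∑ l : Fin d, j * a j * (MvPolynomial.aeval (evalPoint d s a) (c (n + j) l) *
            f (s + (l : ℕ) + 1)) := by
        intro j hj
        have := hc (n + j) (by have := (Finset.mem_Ico.1 hj).2; omega) f a s hf hs
        rw [← Finset.mul_sum, ← this]
        congr 2
        push_cast; ring
      rw [e1, hf _ hz, Finset.sum_congr rfl e2, hc n (by omega) f a s hf hs, Finset.sum_comm,
        Finset.mul_sum, ← Finset.sum_add_distrib]
      refine Finset.sum_congr rfl fun l _ => ?_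
      simp only [map_add, map_mul, map_sum, map_natCast, map_one, hv0]
      rw [add_mul _ _ (f _), Finset.sum_mul, mul_assoc]
      congr 1
      refine Finset.sum_congr rfl fun j hj => ?_
      rw [hv j hj]
      ring

lemma hasDerivAt_det {n : Type*} [Fintype n] [DecidableEq n] {W : ℂ → Matrix n n ℂ}
    {B : Matrix n n ℂ} {x : ℂ}
    (hW : ∀ k l, HasDerivAt (fun y => W y k l) (∑ i, B l i * W x k i) x) :
    HasDerivAt (fun y => (W y).det) ((∑ l, B l l) * (W x).det) x := by
  let D : ContinuousMultilinearMap ℂ (fun _ : n => n → ℂ) ℂ :=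
    { (Matrix.detRowAlternating : (n → ℂ) [⋀^n]→ₗ[ℂ] ℂ).toMultilinearMap with
      cont := Continuous.matrix_det (A := fun M : Matrix n n ℂ => M) continuous_id }
  have hD : ∀ M : n → n → ℂ, D M = Matrix.det (Matrix.of M) := fun _ => rfl
  have hcol : ∀ l, HasFDerivAt (fun y k => W y k l)
      (ContinuousLinearMap.toSpanSingleton ℂ (fun k => ∑ i, B l i * W x k i)) x :=
    fun l => (hasDerivAt_pi.2 fun k => hW k l).hasFDerivAt
  have h := (HasFDerivAt.multilinear_comp D hcol).hasDerivAt
  have e1 : (fun y => (W y).det) = fun y => D fun l k => W y k l := by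
    funext y
    rw [hD, ← Matrix.det_transpose]
    rfl
  rw [e1]
  refine h.congr_deriv ?_
  rw [Finset.sum_mul, sum_apply]
  refine Finset.sum_congr rfl fun l _ => ?_
  have key := Matrix.det_updateCol_sum (W x) l (B l)
  simp only [smul_eq_mul] at key
  rw [← key, ← Matrix.det_transpose, ← Matrix.updateRow_transpose]
  simp only [ContinuousLinearMap.comp_apply, ContinuousLinearMap.toSpanSingleton_apply, one_smul]
  rfl

lemma eq_mul_exp_of_hasDerivAt {g q p : ℂ → ℂ} (hg : ∀ x, HasDerivAt g (p x * g x) x)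
    (hq : ∀ x, HasDerivAt q (p x) x) (hq0 : q 0 = 0) : g 1 = g 0 * Complex.exp (q 1) := by
  have h : ∀ x, HasDerivAt (fun x => g x * Complex.exp (-q x)) 0 x := fun x =>
    ((hg x).mul (hq x).neg.cexp).congr_deriv (by ring)
  have := is_const_of_deriv_eq_zero (fun x => (h x).differentiableAt) (fun x => (h x).deriv) 1 0
  simp only [hq0, neg_zero, Complex.exp_zero, mul_one] at this
  rw [← this, mul_assoc, ← Complex.exp_add, neg_add_cancel, Complex.exp_zero, mul_one]

lemma exists_det_OmegaFn_eq {d : ℕ} (hd : 1 ≤ d) :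
    ∃ Q : MvPolynomial (Fin d) ℚ,
      (∀ s, MvPolynomial.aeval (evalPoint d s fun _ => 0) Q = 0) ∧
      ∀ (a : ℕ → ℂ) (s : ℂ), 0 < s.re →
        Matrix.det (Matrix.of fun k l : Fin d => OmegaFn d a (k : ℕ) (s + (l : ℕ) + 1)) =
          Matrix.det (Matrix.of fun k l : Fin d =>
            OmegaFn d (fun _ => 0) (k : ℕ) (s + (l : ℕ) + 1)) *
          Complex.exp (MvPolynomial.aeval (evalPoint d s a) Q) := by
  choose c hc using fun m => exists_reduction hd m
  have hA : ∀ j : ℕ, ∃ Q : MvPolynomial (Fin d) ℚ, j ∈ Finset.Ico 1 d →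
      (∀ s, MvPolynomial.aeval (evalPoint d s fun _ => 0) Q = 0) ∧
      ∀ (s : ℂ) (a : ℕ → ℂ) (x : ℂ), HasDerivAt
        (fun x : ℂ => MvPolynomial.aeval (evalPoint d s fun n => x * a n) Q)
        (a j * MvPolynomial.aeval (evalPoint d s fun n => x * a n)
          (∑ l : Fin d, c (l + j) l)) x := by
    intro j
    by_cases h : j ∈ Finset.Ico 1 d
    · obtain ⟨h1, h2⟩ := Finset.mem_Ico.1 h
      obtain ⟨Q, hQ⟩ := exists_radial_antiderivative h1 h2 (∑ l : Fin d, c (l + j) l)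
      exact ⟨Q, fun _ => hQ⟩
    · exact ⟨0, fun h' => absurd h' h⟩
  choose Q hQ using hA
  have hQ0 : ∀ s, MvPolynomial.aeval (evalPoint d s fun _ => 0) (∑ j ∈ Finset.Ico 1 d, Q j) =
      0 := by
    intro s
    rw [map_sum]
    exact Finset.sum_eq_zero fun j hj => (hQ j hj).1 s
  refine ⟨∑ j ∈ Finset.Ico 1 d, Q j, hQ0, fun a s hs => ?_⟩
  have hre : ∀ l : Fin d, 0 < (s + (l : ℕ) + 1).re := by
    intro l
    simp only [Complex.add_re, Complex.natCast_re, Complex.one_re]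
    positivity
  have hdet := fun x : ℂ => hasDerivAt_det (x := x)
    (W := fun x : ℂ => Matrix.of fun k l : Fin d =>
      OmegaFn d (fun n => x * a n) (k : ℕ) (s + (l : ℕ) + 1))
    (B := Matrix.of fun l i : Fin d => ∑ j ∈ Finset.Ico 1 d, a j *
      MvPolynomial.aeval (evalPoint d s fun n => x * a n) (c (l + j) i)) fun k l => by
    refine (hasDerivAt_OmegaFn_smul hd a k (hre l) x).congr_deriv ?_
    simp only [Matrix.of_apply, Finset.sum_mul]
    rw [Finset.sum_comm]
    refine Finset.sum_congr rfl fun j _ => ?_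
    have := hc (l + j) (OmegaFn d (fun n => x * a n) k) (fun n => x * a n) s
      (fun z hz => OmegaFn_add_degree hd _ k hz) hs
    simp only [mul_assoc]
    rw [← Finset.mul_sum, ← this]
    congr 2
    push_cast; ring
  have h := eq_mul_exp_of_hasDerivAt hdet
    (q := fun x => MvPolynomial.aeval (evalPoint d s fun n => x * a n)
      (∑ j ∈ Finset.Ico 1 d, Q j)) ?_ ?_
  · simpa only [one_mul, zero_mul] using h
  · intro x
    simp only [map_sum]
    refine (HasDerivAt.fun_sum fun j hj => (hQ j hj).2 s a x).congr_deriv ?_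
    simp only [Matrix.of_apply, map_sum, Finset.mul_sum]
    exact Finset.sum_comm
  · simpa only [zero_mul] using hQ0 s

lemma compl_negIntegers_eq :
    {s : ℂ | ∀ n : ℕ, s ≠ -((n : ℂ) + 1)} = (Set.range fun n : ℕ => -((n : ℂ) + 1))ᶜ := by
  ext s
  simp [eq_comm]

lemma isOpen_compl_negIntegers : IsOpen {s : ℂ | ∀ n : ℕ, s ≠ -((n : ℂ) + 1)} := by
  rw [compl_negIntegers_eq, isOpen_compl_iff]
  have h : Topology.IsClosedEmbedding fun n : ℕ => -((n : ℂ) + 1) := by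
    have h1 : Topology.IsClosedEmbedding fun n : ℕ => (n : ℂ) :=
      Complex.isometry_ofReal.isClosedEmbedding.comp Nat.isClosedEmbedding_coe_real
    exact ((Homeomorph.addRight (1 : ℂ)).trans (Homeomorph.neg ℂ)).isClosedEmbedding.comp h1
  exact h.isClosed_range

lemma isPreconnected_compl_negIntegers :
    IsPreconnected {s : ℂ | ∀ n : ℕ, s ≠ -((n : ℂ) + 1)} := by
  rw [compl_negIntegers_eq]
  exact ((Set.countable_range _).isConnected_compl_of_one_lt_rank
    (by simp [Complex.rank_real_complex])).isPreconnected

lemma differentiableOn_det {n : Type*} [Fintype n] [DecidableEq n] {W : ℂ → Matrix n n ℂ}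
    {U : Set ℂ} (hW : ∀ k l, DifferentiableOn ℂ (fun z => W z k l) U) :
    DifferentiableOn ℂ (fun z => (W z).det) U := by
  simp only [Matrix.det_apply]
  exact DifferentiableOn.fun_sum fun σ _ =>
    (DifferentiableOn.fun_finsetProd fun i _ => hW _ _).const_smul _

lemma differentiable_aeval_evalPoint (d : ℕ) (a : ℕ → ℂ) (Q : MvPolynomial (Fin d) ℚ) :
    Differentiable ℂ fun s => MvPolynomial.aeval (evalPoint d s a) Q := by
  induction Q using MvPolynomial.induction_on with
  | C r => simp
  | add p q hp hq => simp only [map_add]; exact hp.add hq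
  | mul_X p i hp =>
    simp only [map_mul, MvPolynomial.aeval_X]
    refine hp.mul ?_
    unfold evalPoint
    split_ifs <;> fun_prop

/-- There is a polynomial `Π_d` in the variables `(s, a_1, …, a_{d-1})` with
rational coefficients, vanishing when `a_1 = … = a_{d-1} = 0`, such that
`Δ(s | a_1,…,a_{d-1}) = Δ(s | 0,…,0) · exp(Π_d(s, a_1,…,a_{d-1}))` for all `a` and all
`s ∉ {-1,-2,…}`, where `Δ(s|a)` is the determinant of the matrix `[F_{k-1}(s+l | a)]`. -/
theorem stmt10 (d : ℕ) (hd : 1 ≤ d)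
    (F : (ℕ → ℂ) → ℕ → ℂ → ℂ)
    (hFdiff : ∀ a : ℕ → ℂ, ∀ k, k ≤ d - 1 →
      DifferentiableOn ℂ (F a k) {s : ℂ | ∀ n : ℕ, s ≠ -(n : ℂ)})
    (hFΩ : ∀ a : ℕ → ℂ, ∀ k, k ≤ d - 1 → ∀ s : ℂ, 0 < s.re → F a k s = OmegaFn d a k s) :
    ∃ Pi : MvPolynomial (Fin d) ℚ,
      (∀ s : ℂ,
        MvPolynomial.aeval (fun i : Fin d => if (i : ℕ) = 0 then s else 0) Pi = 0) ∧
      ∀ a : ℕ → ℂ, ∀ s : ℂ, (∀ n : ℕ, s ≠ -((n : ℂ) + 1)) →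
        Matrix.det (Matrix.of fun k l : Fin d => F a (k : ℕ) (s + (l : ℕ) + 1))
          = Matrix.det (Matrix.of fun k l : Fin d =>
                F (fun _ => 0) (k : ℕ) (s + (l : ℕ) + 1)) *
              Complex.exp
                (MvPolynomial.aeval
                  (fun i : Fin d => if (i : ℕ) = 0 then s else a (i : ℕ)) Pi) := by
  obtain ⟨Q, hQ0, hQ⟩ := exists_det_OmegaFn_eq hd
  refine ⟨Q, hQ0, fun a => ?_⟩
  set U : Set ℂ := {s : ℂ | ∀ n : ℕ, s ≠ -((n : ℂ) + 1)} with hU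
  have hdet : ∀ b : ℕ → ℂ, DifferentiableOn ℂ (fun s => Matrix.det
      (Matrix.of fun k l : Fin d => F b (k : ℕ) (s + (l : ℕ) + 1))) U := fun b =>
    differentiableOn_det fun k l => by
      refine (hFdiff b k (by omega)).comp (f := fun s : ℂ => s + (l : ℕ) + 1)
        (by fun_prop) fun s hs n hn => hs (n + l) ?_
      push_cast
      linear_combination hn
  have h0 := (hdet a).analyticOnNhd isOpen_compl_negIntegers
  have h1 := ((hdet fun _ => 0).mul
    (differentiable_aeval_evalPoint d a Q).cexp.differentiableOn).analyticOnNhd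
    isOpen_compl_negIntegers
  have h1U : (1 : ℂ) ∈ U := by
    intro n hn
    have := congrArg Complex.re hn
    simp only [Complex.one_re, Complex.neg_re, Complex.add_re, Complex.natCast_re] at this
    have : (0 : ℝ) ≤ n := n.cast_nonneg
    linarith
  refine fun s hs => h0.eqOn_of_preconnected_of_eventuallyEq h1
    isPreconnected_compl_negIntegers h1U ?_ hs
  filter_upwards [(isOpen_lt continuous_const Complex.continuous_re).mem_nhds
    (show (0 : ℝ) < (1 : ℂ).re by simp)] with z hz
  have hz : 0 < z.re := hz
  have hF : ∀ b : ℕ → ℂ, (Matrix.of fun k l : Fin d => F b (k : ℕ) (z + (l : ℕ) + 1)) =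
      Matrix.of fun k l : Fin d => OmegaFn d b (k : ℕ) (z + (l : ℕ) + 1) := by
    intro b
    ext k l
    refine hFΩ b k (by omega) _ ?_
    simp only [Complex.add_re, Complex.natCast_re, Complex.one_re]
    positivity
  simp only [Pi.mul_apply, hF]
  exact hQ a z hz
end

section
/- The Omega functions have no common zero outside the nonpositive integers: for every s_0 ∈ ℂ ∖ {0, −1, −2, …}, the values F_0(s_0), F_1(s_0), …, F_{d−1}(s_0) are not all zero. -/
open Filter Topology MeasureTheory

section PowerSeries

variable {c : ℕ → ℂ} {s : ℂ}

/-- The points of `ℂ` which are not nonpositive integers. -/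
def gammaDomain : Set ℂ := {s : ℂ | ∀ n : ℕ, s ≠ -(n : ℂ)}

lemma isOpen_gammaDomain : IsOpen gammaDomain := by
  have h : gammaDomain = (fun s => (Complex.Gamma s)⁻¹) ⁻¹' {0}ᶜ := by
    ext s
    simp [gammaDomain, Complex.Gamma_eq_zero_iff]
  rw [h]
  exact isOpen_compl_singleton.preimage Complex.differentiable_one_div_Gamma.continuous

lemma isPreconnected_gammaDomain : IsPreconnected gammaDomain := by
  have h : gammaDomain = (Set.range fun n : ℕ => -(n : ℂ))ᶜ := by
    ext s
    simp [gammaDomain, eq_comm]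
  rw [h]
  exact ((Set.countable_range _).isPathConnected_compl_of_one_lt_rank
    (by rw [Complex.rank_real_complex]; exact Cardinal.one_lt_two)).isConnected.isPreconnected

/-- The formal solution `∑ c_n t^n / (n + s)` of `t H' + s H = ∑ c_n t^n`. -/
noncomputable def shiftedSeries (c : ℕ → ℂ) (s t : ℂ) : ℂ := ∑' n : ℕ, c n * t ^ n / (n + s)

lemma exists_dist_bound (hs : s ∈ gammaDomain) :
    ∃ ε > 0, ∀ w ∈ Metric.ball s ε, ∀ n : ℕ, ε ≤ ‖(n : ℂ) + w‖ := by
  obtain ⟨ε, hε, hball⟩ := Metric.isOpen_iff.1 isOpen_gammaDomain s hs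
  refine ⟨ε / 2, by positivity, fun w hw n => ?_⟩
  by_contra! hlt
  have hmem : -(n : ℂ) ∈ Metric.ball s ε := by
    rw [Metric.mem_ball] at hw ⊢
    have h1 : dist (-(n : ℂ)) w = ‖(n : ℂ) + w‖ := by
      rw [dist_eq_norm, ← norm_neg]; congr 1; ring
    linarith [dist_triangle (-(n : ℂ)) w s]
  exact hball hmem n rfl

lemma shiftedSeries_term_le {ε r : ℝ} (hε : 0 < ε) {w t : ℂ} (n : ℕ)
    (hw : ε ≤ ‖(n : ℂ) + w‖) (ht : ‖t‖ ≤ r) :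
    ‖c n * t ^ n / (n + w)‖ ≤ ‖c n * (r : ℂ) ^ n‖ / ε := by
  have hr : 0 ≤ r := (norm_nonneg t).trans ht
  rw [norm_div, norm_mul, norm_mul, norm_pow, norm_pow, Complex.norm_of_nonneg hr]
  gcongr

lemma differentiableOn_shiftedSeries_param (hc : ∀ t : ℂ, Summable fun n => c n * t ^ n) (t : ℂ) :
    DifferentiableOn ℂ (fun s => shiftedSeries c s t) gammaDomain := by
  intro s hs
  obtain ⟨ε, hε, hb⟩ := exists_dist_bound hs
  refine DifferentiableAt.differentiableWithinAt ?_
  refine (Complex.differentiableOn_tsum_of_summable_norm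
    (u := fun n => ‖c n * ((‖t‖ : ℝ) : ℂ) ^ n‖ / ε) ((hc _).norm.div_const ε) (fun n => ?_)
    Metric.isOpen_ball (fun n w hw => shiftedSeries_term_le hε n (hb w hw n) le_rfl)).differentiableAt
    (Metric.ball_mem_nhds s hε)
  intro w hw
  have h0 : (n : ℂ) + w ≠ 0 := norm_pos_iff.1 (hε.trans_le (hb w hw n))
  exact DifferentiableAt.differentiableWithinAt (by fun_prop (disch := exact h0))

lemma shiftedSeries_differentiable (hc : ∀ t : ℂ, Summable fun n => c n * t ^ n)
    (hs : s ∈ gammaDomain) : Differentiable ℂ (shiftedSeries c s) := by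
  intro t
  obtain ⟨ε, hε, hb⟩ := exists_dist_bound hs
  have hb' := hb s (Metric.mem_ball_self hε)
  refine (Complex.differentiableOn_tsum_of_summable_norm
    (u := fun n => ‖c n * ((‖t‖ + 1 : ℝ) : ℂ) ^ n‖ / ε) ((hc _).norm.div_const ε)
    (fun n => Differentiable.differentiableOn (by fun_prop)) (U := Metric.ball 0 (‖t‖ + 1))
    Metric.isOpen_ball (fun n w hw => shiftedSeries_term_le hε n (hb' n) ?_)).differentiableAt
    (Metric.isOpen_ball.mem_nhds (by simp))
  exact (mem_ball_zero_iff.1 hw).le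

lemma shiftedSeries_ode (hc : ∀ t : ℂ, Summable fun n => c n * t ^ n)
    (hs : s ∈ gammaDomain) (t : ℂ) :
    t * deriv (shiftedSeries c s) t + s * shiftedSeries c s t = ∑' n, c n * t ^ n := by
  obtain ⟨ε, hε, hb⟩ := exists_dist_bound hs
  have hb' := hb s (Metric.mem_ball_self hε)
  have hbound : ∀ (n : ℕ), ∀ w ∈ Metric.ball (0 : ℂ) (‖t‖ + 1),
      ‖c n * w ^ n / (n + s)‖ ≤ ‖c n * ((‖t‖ + 1 : ℝ) : ℂ) ^ n‖ / ε := fun n w hw =>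
    shiftedSeries_term_le hε n (hb' n) (mem_ball_zero_iff.1 hw).le
  have hsum := (hc ((‖t‖ + 1 : ℝ) : ℂ)).norm.div_const ε
  have ht : t ∈ Metric.ball (0 : ℂ) (‖t‖ + 1) := by simp
  have h1 := Complex.hasSum_deriv_of_summable_norm hsum
    (fun n => Differentiable.differentiableOn (by fun_prop)) Metric.isOpen_ball hbound ht
  have h2 : Summable fun n : ℕ => c n * t ^ n / (n + s) :=
    Summable.of_norm_bounded hsum fun n => hbound n t ht
  have h3 := (h1.mul_left t).add (h2.hasSum.mul_left s)
  refine (h3.tsum_eq.symm.trans ?_)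
  congr 1
  ext n
  have h0 : (n : ℂ) + s ≠ 0 := norm_pos_iff.1 (hε.trans_le (hb' n))
  have hd : deriv (fun w : ℂ => c n * w ^ n / (n + s)) t = c n * (n * t ^ (n - 1)) / (n + s) := by
    simp
  rw [hd]
  have hpow : t * (n * t ^ (n - 1)) = n * t ^ n := by
    rcases n with _ | n
    · simp
    · simp [pow_succ]; ring
  field_simp
  linear_combination c n * hpow

end PowerSeries

section Rays

variable {P T g : ℂ → ℂ} {s : ℂ}

/-- The weight `u^s e^{P(ζ u)}` on the ray through `ζ`. -/
noncomputable def rayWeight (P : ℂ → ℂ) (s ζ : ℂ) (u : ℝ) : ℂ :=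
  Complex.exp (s * (Real.log u : ℂ) + P (ζ * u))

lemma hasDerivAt_comp_ray {f : ℂ → ℂ} (hf : Differentiable ℂ f) (ζ : ℂ) (u : ℝ) :
    HasDerivAt (fun v : ℝ => f (ζ * v)) (ζ * deriv f (ζ * u)) u := by
  have h1 : HasDerivAt (fun v : ℝ => ζ * (v : ℂ)) (ζ * 1) u :=
    (Complex.ofRealCLM.hasDerivAt (x := u)).const_mul ζ
  have h2 := (hf (ζ * u)).hasDerivAt.comp u h1
  rw [mul_one, mul_comm] at h2
  exact h2

lemma hasDerivAt_rayExponent (hP : Differentiable ℂ P) (hT : ∀ t, t * deriv P t = T t)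
    (ζ : ℂ) {u : ℝ} (hu : 0 < u) :
    HasDerivAt (fun v : ℝ => s * (Real.log v : ℂ) + P (ζ * v)) ((s + T (ζ * u)) / u) u := by
  have h1 : HasDerivAt (fun v : ℝ => s * (Real.log v : ℂ)) (s * ((u⁻¹ : ℝ) : ℂ)) u :=
    ((Real.hasDerivAt_log hu.ne').ofReal_comp).const_mul s
  refine (h1.add (hasDerivAt_comp_ray hP ζ u)).congr_deriv ?_
  have hu' : (u : ℂ) ≠ 0 := by exact_mod_cast hu.ne'
  rw [← hT]
  push_cast
  field_simp

lemma hasDerivAt_norm_rayWeight (hP : Differentiable ℂ P) (hT : ∀ t, t * deriv P t = T t)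
    (ζ : ℂ) {u : ℝ} (hu : 0 < u) :
    HasDerivAt (fun v => ‖rayWeight P s ζ v‖)
      (‖rayWeight P s ζ u‖ / u * (s + T (ζ * u)).re) u := by
  have h := Complex.reCLM.hasFDerivAt.comp_hasDerivAt u (hasDerivAt_rayExponent (s := s) hP hT ζ hu)
  have h2 := h.exp
  simp only [rayWeight, Complex.norm_exp]
  refine h2.congr_deriv ?_
  simp only [Function.comp, Complex.reCLM_apply, Complex.div_ofReal_re]
  ring

lemma hasDerivAt_rayWeight_mul (hP : Differentiable ℂ P) (hT : ∀ t, t * deriv P t = T t)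
    (hg : Differentiable ℂ g) (hode : ∀ t, t * deriv g t + (s + T t) * g t = 1)
    (ζ : ℂ) {u : ℝ} (hu : 0 < u) :
    HasDerivAt (fun v : ℝ => rayWeight P s ζ v * g (ζ * v)) (rayWeight P s ζ u / u) u := by
  have h := (hasDerivAt_rayExponent (s := s) hP hT ζ hu).cexp.mul (hasDerivAt_comp_ray hg ζ u)
  refine h.congr_deriv ?_
  have hu' : (u : ℂ) ≠ 0 := by exact_mod_cast hu.ne'
  rw [rayWeight]
  have := hode (ζ * u)
  field_simp
  linear_combination this

lemma norm_rayWeight_pos (ζ : ℂ) (u : ℝ) : 0 < ‖rayWeight P s ζ u‖ :=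
  norm_pos_iff.2 (Complex.exp_ne_zero _)

lemma norm_le_of_growth (hP : Differentiable ℂ P) (hT : ∀ t, t * deriv P t = T t)
    (hg : Differentiable ℂ g) (hode : ∀ t, t * deriv g t + (s + T t) * g t = 1)
    {ζ : ℂ} {R K : ℝ} (hR : 0 < R) (hK : ‖g (ζ * R)‖ ≤ K)
    (hre : ∀ u : ℝ, R ≤ u → 1 ≤ (s + T (ζ * u)).re) {u : ℝ} (hu : R ≤ u) :
    ‖g (ζ * u)‖ ≤ 1 + K := by
  have hK0 : 0 ≤ K := (norm_nonneg _).trans hK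
  have key := image_norm_le_of_norm_deriv_right_le_deriv_boundary'
    (f := fun v : ℝ => rayWeight P s ζ v * g (ζ * v)) (a := R) (b := u)
    (f' := fun v => rayWeight P s ζ v / v)
    (fun v hv => (hasDerivAt_rayWeight_mul hP hT hg hode ζ
      (hR.trans_le hv.1)).continuousAt.continuousWithinAt)
    (fun v hv => (hasDerivAt_rayWeight_mul hP hT hg hode ζ (hR.trans_le hv.1)).hasDerivWithinAt)
    (B := fun v => ‖rayWeight P s ζ v‖ * (1 + K))
    (B' := fun v => ‖rayWeight P s ζ v‖ / v * (s + T (ζ * v)).re * (1 + K))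
    (by rw [norm_mul]; gcongr; linarith)
    (fun v hv => ((hasDerivAt_norm_rayWeight hP hT ζ
      (hR.trans_le hv.1)).mul_const _).continuousAt.continuousWithinAt)
    (fun v hv => ((hasDerivAt_norm_rayWeight hP hT ζ
      (hR.trans_le hv.1)).mul_const _).hasDerivWithinAt)
    (fun v hv => by
      have hv0 : 0 < v := hR.trans_le hv.1
      rw [norm_div, Complex.norm_of_nonneg hv0.le, mul_assoc]
      refine le_mul_of_one_le_right (by positivity) ?_
      nlinarith [hre v hv.1])
    (Set.right_mem_Icc.2 hu)
  rw [norm_mul] at key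
  exact le_of_mul_le_mul_left key (norm_rayWeight_pos ζ u)

lemma norm_le_of_decay (hP : Differentiable ℂ P) (hT : ∀ t, t * deriv P t = T t)
    (hg : Differentiable ℂ g) (hode : ∀ t, t * deriv g t + (s + T t) * g t = 1)
    {ζ : ℂ} {R : ℝ} (hR : 0 < R)
    (hre : ∀ u : ℝ, R ≤ u → (s + T (ζ * u)).re ≤ -1)
    (hlim : Tendsto (fun u : ℝ => rayWeight P s ζ u * g (ζ * u)) atTop (𝓝 0))
    {u : ℝ} (hu : R ≤ u) :
    ‖g (ζ * u)‖ ≤ 1 := by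
  have hu0 : 0 < u := hR.trans_le hu
  have key : ∀ w, u ≤ w → ‖rayWeight P s ζ w * g (ζ * w) - rayWeight P s ζ u * g (ζ * u)‖
      ≤ ‖rayWeight P s ζ u‖ := by
    intro w hw
    have := image_norm_le_of_norm_deriv_right_le_deriv_boundary'
      (f := fun v : ℝ => rayWeight P s ζ v * g (ζ * v) - rayWeight P s ζ u * g (ζ * u))
      (a := u) (b := w) (f' := fun v => rayWeight P s ζ v / v)
      (fun v hv => ((hasDerivAt_rayWeight_mul hP hT hg hode ζ
        (hu0.trans_le hv.1)).sub_const _).continuousAt.continuousWithinAt)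
      (fun v hv => ((hasDerivAt_rayWeight_mul hP hT hg hode ζ
        (hu0.trans_le hv.1)).sub_const _).hasDerivWithinAt)
      (B := fun v => ‖rayWeight P s ζ u‖ - ‖rayWeight P s ζ v‖)
      (B' := fun v => -(‖rayWeight P s ζ v‖ / v * (s + T (ζ * v)).re))
      (by simp)
      (fun v hv => ((hasDerivAt_norm_rayWeight hP hT ζ
        (hu0.trans_le hv.1)).const_sub _).continuousAt.continuousWithinAt)
      (fun v hv => ((hasDerivAt_norm_rayWeight hP hT ζ
        (hu0.trans_le hv.1)).const_sub _).hasDerivWithinAt)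
      (fun v hv => by
        have hv0 : 0 < v := hu0.trans_le hv.1
        rw [norm_div, Complex.norm_of_nonneg hv0.le, ← mul_neg]
        refine le_mul_of_one_le_right (by positivity) ?_
        linarith [hre v (hu.trans hv.1)])
      (Set.right_mem_Icc.2 hw)
    exact this.trans (sub_le_self _ (norm_nonneg _))
  have h2 := le_of_tendsto (hlim.sub_const (rayWeight P s ζ u * g (ζ * u))).norm
    (eventually_atTop.2 ⟨u, key⟩)
  rw [zero_sub, norm_neg, norm_mul] at h2
  exact le_of_mul_le_mul_left (h2.trans_eq (mul_one _).symm) (norm_rayWeight_pos ζ u)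

lemma norm_le_exp_of_ode {d : ℕ} (hd : 1 ≤ d) {A K : ℝ} (hA : 0 ≤ A)
    (hg : Differentiable ℂ g) (hode : ∀ t, t * deriv g t + (s + T t) * g t = 1)
    (hTA : ∀ t, 1 ≤ ‖t‖ → ‖T t‖ ≤ A * ‖t‖ ^ d) (hK : ∀ t, ‖t‖ ≤ 1 → ‖g t‖ ≤ K) (t : ℂ) :
    ‖g t‖ ≤ (K + 1) * Real.exp ((A + ‖s‖ + 2) * ‖t‖ ^ d) := by
  have hK0 : 0 ≤ K := (norm_nonneg _).trans (hK 0 (by simp))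
  have hexp : ∀ v : ℝ, 0 ≤ v → 1 ≤ Real.exp ((A + ‖s‖ + 2) * v ^ d) := fun v hv =>
    Real.one_le_exp (by positivity)
  rcases le_total ‖t‖ 1 with ht | ht
  · nlinarith [hK t ht, hexp ‖t‖ (norm_nonneg t)]
  set ζ : ℂ := t / ‖t‖ with hζ
  have ht0 : (‖t‖ : ℂ) ≠ 0 := by exact_mod_cast (by linarith : ‖t‖ ≠ 0)
  have hζ1 : ‖ζ‖ = 1 := by
    rw [hζ, norm_div, Complex.norm_real, norm_norm, div_self]; linarith
  have hζt : ζ * (‖t‖ : ℝ) = t := by rw [hζ]; field_simp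
  have hB : ∀ v : ℝ, HasDerivAt (fun v : ℝ => (K + 1) * Real.exp ((A + ‖s‖ + 2) * v ^ d))
      ((K + 1) * (Real.exp ((A + ‖s‖ + 2) * v ^ d) * ((A + ‖s‖ + 2) * (d * v ^ (d - 1))))) v :=
    fun v => (((hasDerivAt_pow d v).const_mul _).exp).const_mul _
  have key := image_norm_le_of_norm_deriv_right_lt_deriv_boundary'
    (f := fun v : ℝ => g (ζ * v)) (a := 1) (b := ‖t‖)
    (f' := fun v => ζ * deriv g (ζ * v))
    (fun v hv => (hasDerivAt_comp_ray hg ζ v).continuousAt.continuousWithinAt)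
    (fun v hv => (hasDerivAt_comp_ray hg ζ v).hasDerivWithinAt)
    (B := fun v : ℝ => (K + 1) * Real.exp ((A + ‖s‖ + 2) * v ^ d))
    (by
      have := hK (ζ * (1 : ℝ)) (by simp [hζ1])
      nlinarith [hexp 1 zero_le_one])
    (fun v hv => (hB v).continuousAt.continuousWithinAt)
    (fun v hv => (hB v).hasDerivWithinAt)
    (fun v hv hEq => by
      obtain ⟨hv1, -⟩ := hv
      have hv0 : 0 < v := by linarith
      have hvn : ‖ζ * (v : ℂ)‖ = v := by
        rw [norm_mul, hζ1, one_mul, Complex.norm_of_nonneg hv0.le]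
      set G := (K + 1) * Real.exp ((A + ‖s‖ + 2) * v ^ d) with hG
      have hG1 : 1 ≤ G := by nlinarith [hexp v hv0.le]
      have hpow : v * v ^ (d - 1) = v ^ d := by
        rw [← pow_succ', Nat.sub_add_cancel hd]
      have hpow1 : 1 ≤ v ^ d := one_le_pow₀ hv1
      have h1 : v * ‖ζ * deriv g (ζ * v)‖ = ‖1 - (s + T (ζ * v)) * g (ζ * v)‖ := by
        rw [← hode (ζ * v), add_sub_cancel_right]
        simp only [norm_mul, Complex.norm_of_nonneg hv0.le]
        ring
      have h2 : ‖1 - (s + T (ζ * v)) * g (ζ * v)‖ ≤ 1 + (‖s‖ + A * v ^ d) * G := by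
        refine (norm_sub_le _ _).trans ?_
        rw [norm_one, norm_mul, hEq]
        have := hTA (ζ * v) (by rw [hvn]; exact hv1)
        rw [hvn] at this
        gcongr
        exact (norm_add_le _ _).trans (by gcongr)
      have h3 : 1 + (‖s‖ + A * v ^ d) * G < (A + ‖s‖ + 2) * (d * v ^ d) * G := by
        have hd1 : (1 : ℝ) ≤ d := by exact_mod_cast hd
        have e1 : v ^ d ≤ d * v ^ d := le_mul_of_one_le_left (by positivity) hd1
        have e2 : 1 + ‖s‖ + A * v ^ d < (A + ‖s‖ + 2) * (d * v ^ d) := by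
          nlinarith [norm_nonneg s]
        nlinarith [norm_nonneg s]
      refine lt_of_mul_lt_mul_left (a := v) ?_ hv0.le
      rw [h1]
      refine (h2.trans_lt h3).trans_eq ?_
      rw [hG, ← hpow]; ring)
    (Set.right_mem_Icc.2 ht)
  simpa [hζt] using key

end Rays

section Polynomial

variable {d : ℕ} {a : ℕ → ℂ} {s : ℂ}

/-- The polynomial `t P₀'(t)`. -/
noncomputable def eulerP0 (d : ℕ) (a : ℕ → ℂ) (t : ℂ) : ℂ :=
  -t ^ d + ∑ k ∈ Finset.Ico 1 d, k * a k * t ^ k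

/-- The root of unity `e^{2πik/d}`. -/
noncomputable def unityRoot (d k : ℕ) : ℂ := Complex.exp (2 * Real.pi * Complex.I * k / d)

lemma differentiable_P0 : Differentiable ℂ (P0 d a) := by
  unfold P0
  fun_prop

lemma mul_deriv_P0 (hd : 1 ≤ d) (t : ℂ) : t * deriv (P0 d a) t = eulerP0 d a t := by
  have h : HasDerivAt (P0 d a) (-(d * t ^ (d - 1)) / d +
      ∑ k ∈ Finset.Ico 1 d, a k * (k * t ^ (k - 1))) t := by
    unfold P0
    exact ((hasDerivAt_pow d t).neg.div_const _).add
      (HasDerivAt.fun_sum fun k _ => (hasDerivAt_pow k t).const_mul _)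
  have hpow : ∀ k, 1 ≤ k → t * t ^ (k - 1) = t ^ k := fun k hk => by
    rw [← pow_succ', Nat.sub_add_cancel hk]
  rw [h.deriv, eulerP0, mul_add, Finset.mul_sum]
  congr 1
  · have : (d : ℂ) ≠ 0 := by exact_mod_cast (by omega : d ≠ 0)
    rw [← hpow d hd]
    field_simp
  · refine Finset.sum_congr rfl fun k hk => ?_
    rw [← hpow k (Finset.mem_Ico.1 hk).1]
    ring

lemma exists_eulerP0_add_pow_le (hd : 1 ≤ d) :
    ∃ A : ℝ, 0 ≤ A ∧ ∀ t : ℂ, 1 ≤ ‖t‖ → ‖eulerP0 d a t + t ^ d‖ ≤ A * ‖t‖ ^ (d - 1) := by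
  refine ⟨∑ k ∈ Finset.Ico 1 d, k * ‖a k‖, by positivity, fun t ht => ?_⟩
  rw [eulerP0, add_comm, add_neg_cancel_left, Finset.sum_mul]
  refine norm_sum_le_of_le _ fun k hk => ?_
  rw [norm_mul, norm_mul, norm_pow, Complex.norm_natCast]
  gcongr
  have := Finset.mem_Ico.1 hk
  omega

lemma norm_unityRoot (k : ℕ) : ‖unityRoot d k‖ = 1 := by
  rw [unityRoot, Complex.norm_exp, Real.exp_eq_one_iff]
  rw [show (2 * Real.pi * Complex.I * k / d : ℂ) = ((2 * Real.pi * k / d : ℝ) : ℂ) * Complex.I by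
    push_cast; ring]
  simp

lemma unityRoot_pow (hd : 1 ≤ d) (k : ℕ) : unityRoot d k ^ d = 1 := by
  have : (d : ℂ) ≠ 0 := by exact_mod_cast (by omega : d ≠ 0)
  rw [unityRoot, ← Complex.exp_nat_mul, Complex.exp_eq_one_iff]
  refine ⟨k, ?_⟩
  push_cast
  field_simp

lemma exists_eq_unityRoot_mul_exp (hd : 1 ≤ d) {t : ℂ} (ht : t ≠ 0) :
    ∃ k ≤ d - 1, ∃ z : ℂ, |z.im| ≤ Real.pi / d ∧ t = unityRoot d k * Complex.exp z := by
  have hd0 : (d : ℝ) ≠ 0 := by exact_mod_cast (by omega : d ≠ 0)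
  have hdp : (0 : ℝ) < d := by positivity
  have hdc : (d : ℂ) ≠ 0 := by exact_mod_cast hd0
  have hdz : (d : ℤ) ≠ 0 := by exact_mod_cast (by omega : d ≠ 0)
  set m : ℤ := round (t.arg * d / (2 * Real.pi)) with hm
  set k : ℕ := (m % d).toNat with hk
  have hkm : (k : ℤ) = m % d := Int.toNat_of_nonneg (Int.emod_nonneg _ hdz)
  have hlt : m % d < d := Int.emod_lt_of_pos _ (by omega)
  refine ⟨k, by omega, Complex.log t - 2 * Real.pi * Complex.I * m / d, ?_, ?_⟩
  · have him : (Complex.log t - 2 * Real.pi * Complex.I * m / d).im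
        = 2 * Real.pi / d * (t.arg * d / (2 * Real.pi) - m) := by
      rw [show (2 * Real.pi * Complex.I * m / d : ℂ)
        = ((2 * Real.pi * m / d : ℝ) : ℂ) * Complex.I by push_cast; ring]
      rw [Complex.sub_im, Complex.log_im, Complex.mul_I_im, Complex.ofReal_re]
      field_simp
    rw [him, abs_mul, abs_of_pos (by positivity)]
    calc 2 * Real.pi / d * |t.arg * d / (2 * Real.pi) - m| ≤ 2 * Real.pi / d * (1 / 2) := by
          gcongr
          exact abs_sub_round _
      _ = Real.pi / d := by ring
  · have hroot : unityRoot d k = Complex.exp (2 * Real.pi * Complex.I * m / d) := by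
      rw [unityRoot, Complex.exp_eq_exp_iff_exists_int]
      refine ⟨-(m / d), ?_⟩
      have h1 : (m : ℂ) = d * ((m / d : ℤ) : ℂ) + k := by
        have := Int.mul_ediv_add_emod m d
        rw [← hkm] at this
        exact_mod_cast this.symm
      rw [h1]
      push_cast
      field_simp
      ring
    rw [hroot, ← Complex.exp_add, add_sub_cancel, Complex.exp_log ht]

lemma norm_le_of_strip (hd : 1 ≤ d) {g : ℂ → ℂ} (hg : Differentiable ℂ g) {B C M : ℝ}
    (hB : 0 ≤ B) (hC : 0 ≤ C)
    (hexp : ∀ t, ‖g t‖ ≤ C * Real.exp (B * ‖t‖ ^ d)) {ζ : ℂ} (hζ : ‖ζ‖ = 1) (hζd : ζ ^ d = 1)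
    (hray : ∀ u : ℝ, 0 ≤ u → ‖g (ζ * u)‖ ≤ M)
    (hreg : ∀ t : ℂ, (t ^ d).re ≤ -‖t‖ ^ d / 2 → ‖g t‖ ≤ M) {z : ℂ}
    (hz : |z.im| ≤ Real.pi / d) : ‖g (ζ * Complex.exp z)‖ ≤ M := by
  have hdp : (0 : ℝ) < d := by exact_mod_cast hd
  have hpi := Real.pi_pos
  have hfdiff : Differentiable ℂ fun z => g (ζ * Complex.exp z) := by fun_prop
  have hnorm : ∀ z : ℂ, ‖ζ * Complex.exp z‖ ^ d = Real.exp (d * z.re) := fun z => by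
    rw [norm_mul, hζ, one_mul, Complex.norm_exp, Real.exp_nat_mul]
  have hO : ∀ l : Filter ℂ, (fun z => g (ζ * Complex.exp z)) =O[l]
      fun z => Real.exp (B * Real.exp (d * |z.re|)) := fun l => by
    refine Asymptotics.IsBigO.of_bound C (Eventually.of_forall fun z => ?_)
    refine (hexp _).trans ?_
    rw [hnorm, Real.norm_of_nonneg (Real.exp_pos _).le]
    gcongr
    exact le_abs_self _
  have houter : ∀ z : ℂ, 2 * Real.pi / (3 * d) ≤ |z.im| → |z.im| ≤ Real.pi / d →
      ‖g (ζ * Complex.exp z)‖ ≤ M := by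
    intro z h1 h2
    refine hreg _ ?_
    have h3 : ((ζ * Complex.exp z) ^ d).re = Real.exp (d * z.re) * Real.cos (d * |z.im|) := by
      rw [mul_pow, hζd, one_mul, ← Complex.exp_nat_mul, Complex.exp_re]
      have : Real.cos (d * |z.im|) = Real.cos (d * z.im) := by
        rw [← Real.cos_abs (d * z.im), abs_mul, abs_of_pos hdp]
      rw [this]
      simp
    have h4 : Real.cos (d * |z.im|) ≤ -1 / 2 := by
      have e1 : Real.pi - Real.pi / 3 ≤ d * |z.im| := by
        rw [div_le_iff₀ (by positivity)] at h1
        linarith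
      have e2 : d * |z.im| ≤ Real.pi := by
        rw [le_div_iff₀ hdp] at h2
        linarith
      have := Real.cos_le_cos_of_nonneg_of_le_pi (by linarith) e2 e1
      rw [Real.cos_pi_sub, Real.cos_pi_div_three] at this
      linarith
    rw [h3, hnorm]
    nlinarith [Real.exp_pos (d * z.re)]
  have hinner : ∀ z : ℂ, z.im = 0 → ‖g (ζ * Complex.exp z)‖ ≤ M := by
    intro z h
    have : Complex.exp z = (Real.exp z.re : ℝ) := by
      rw [Complex.ofReal_exp]; congr 1; apply Complex.ext <;> simp [h]
    rw [this]
    exact hray _ (Real.exp_pos _).le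
  have hb : 2 * Real.pi / (3 * d) ≤ Real.pi / d := by
    rw [div_le_div_iff₀ (by positivity) hdp]
    nlinarith
  have hb0 : 0 ≤ 2 * Real.pi / (3 * d) := by positivity
  have hrate : (d : ℝ) < Real.pi / (2 * Real.pi / (3 * d)) := by
    rw [lt_div_iff₀ (by positivity)]
    field_simp
    norm_num
  have hline : ∀ z : ℂ, |z.im| = 2 * Real.pi / (3 * d) → ‖g (ζ * Complex.exp z)‖ ≤ M :=
    fun z h => houter z h.ge (h.trans_le hb)
  by_cases h : 2 * Real.pi / (3 * d) ≤ |z.im|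
  · exact houter z h hz
  push Not at h
  rcases le_total 0 z.im with h0 | h0
  · rw [abs_of_nonneg h0] at h
    exact PhragmenLindelof.horizontal_strip (f := fun z => g (ζ * Complex.exp z))
      hfdiff.diffContOnCl ⟨d, by rwa [sub_zero], B, hO _⟩ hinner
      (fun z hz => hline z (by rw [hz, abs_of_nonneg hb0])) h0 h.le
  · rw [abs_of_nonpos h0] at h
    exact PhragmenLindelof.horizontal_strip (f := fun z => g (ζ * Complex.exp z))
      (a := -(2 * Real.pi / (3 * d))) hfdiff.diffContOnCl
      ⟨d, by rwa [zero_sub, neg_neg], B, hO _⟩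
      (fun z hz => hline z (by rw [hz, abs_neg, abs_of_nonneg hb0])) hinner (by linarith) h0

/-- The real part of `t P₀'(t)` is large and of the expected sign away from the transition
directions. -/
lemma exists_radius_eulerP0 (hd : 1 ≤ d) (N : ℝ) :
    ∃ R : ℝ, 1 ≤ R ∧ (∀ t : ℂ, R ≤ ‖t‖ → (t ^ d).re ≤ -‖t‖ ^ d / 2 → N ≤ (eulerP0 d a t).re) ∧
      ∀ k : ℕ, ∀ u : ℝ, R ≤ u → (eulerP0 d a (unityRoot d k * u)).re ≤ -N := by
  obtain ⟨A, hA, hAt⟩ := exists_eulerP0_add_pow_le (a := a) hd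
  have hpow : ∀ u : ℝ, u * u ^ (d - 1) = u ^ d := fun u => by
    rw [← pow_succ', Nat.sub_add_cancel hd]
  refine ⟨2 * (A + |N| + 1), by linarith [abs_nonneg N], fun t ht hre => ?_, fun k u hu => ?_⟩
  · have ht1 : 1 ≤ ‖t‖ := by linarith [abs_nonneg N]
    have h1 := (abs_le.1 ((Complex.abs_re_le_norm _).trans (hAt t ht1))).1
    rw [Complex.add_re] at h1
    have h2 : 1 ≤ ‖t‖ ^ (d - 1) := one_le_pow₀ ht1
    have h3 := hpow ‖t‖
    nlinarith [le_abs_self N, abs_nonneg N]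
  · have hu1 : 1 ≤ u := by linarith [abs_nonneg N]
    have hn : ‖unityRoot d k * (u : ℂ)‖ = u := by
      rw [norm_mul, norm_unityRoot, one_mul, Complex.norm_of_nonneg (by linarith)]
    have h1 := (abs_le.1 ((Complex.abs_re_le_norm _).trans
      (hAt (unityRoot d k * u) (by rw [hn]; exact hu1)))).2
    rw [Complex.add_re, hn, mul_pow, unityRoot_pow hd, one_mul, ← Complex.ofReal_pow,
      Complex.ofReal_re] at h1
    have h2 : 1 ≤ u ^ (d - 1) := one_le_pow₀ hu1
    have h3 := hpow u
    nlinarith [le_abs_self N, abs_nonneg N]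

lemma exists_bound_of_ode (hd : 1 ≤ d) {g : ℂ → ℂ} (hg : Differentiable ℂ g)
    (hode : ∀ t, t * deriv g t + (s + eulerP0 d a t) * g t = 1)
    (hlim : ∀ k ≤ d - 1, Tendsto
      (fun u : ℝ => rayWeight (P0 d a) s (unityRoot d k) u * g (unityRoot d k * u)) atTop (𝓝 0)) :
    ∃ M, ∀ t, ‖g t‖ ≤ M := by
  have hP := differentiable_P0 (d := d) (a := a)
  have hT := mul_deriv_P0 (a := a) hd
  obtain ⟨R, hR1, hRgrow, hRdec⟩ := exists_radius_eulerP0 (a := a) hd (‖s‖ + 1)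
  have hR0 : 0 < R := by linarith
  have hs := abs_le.1 (Complex.abs_re_le_norm s)
  obtain ⟨K, hK⟩ := (isCompact_closedBall (0 : ℂ) R).exists_bound_of_continuousOn
    hg.continuous.continuousOn
  have hK' : ∀ t, ‖t‖ ≤ R → ‖g t‖ ≤ K := fun t ht => hK t (mem_closedBall_zero_iff.2 ht)
  have hK0 : 0 ≤ K := (norm_nonneg _).trans (hK' 0 (by simpa using hR0.le))
  obtain ⟨A, hA, hAt⟩ := exists_eulerP0_add_pow_le (a := a) hd
  have hTA : ∀ t, 1 ≤ ‖t‖ → ‖eulerP0 d a t‖ ≤ (A + 1) * ‖t‖ ^ d := fun t ht => by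
    have h1 := norm_sub_le (eulerP0 d a t + t ^ d) (t ^ d)
    rw [add_sub_cancel_right, norm_pow] at h1
    have h2 : ‖t‖ ^ (d - 1) ≤ ‖t‖ ^ d := pow_le_pow_right₀ ht (Nat.sub_le _ _)
    nlinarith [hAt t ht]
  have hexp := norm_le_exp_of_ode (s := s) hd (by linarith : 0 ≤ A + 1) hg hode hTA
    (fun t ht => hK' t (ht.trans hR1))
  have hreg : ∀ t : ℂ, (t ^ d).re ≤ -‖t‖ ^ d / 2 → ‖g t‖ ≤ 1 + K := by
    intro t ht
    rcases le_total ‖t‖ R with h | h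
    · linarith [hK' t h]
    have ht0 : 0 < ‖t‖ := hR0.trans_le h
    have ht0' : (‖t‖ : ℂ) ≠ 0 := by exact_mod_cast ht0.ne'
    have hζ1 : ‖t / (‖t‖ : ℂ)‖ = 1 := by
      rw [norm_div, Complex.norm_real, norm_norm, div_self ht0.ne']
    have hζt : t / (‖t‖ : ℂ) * (‖t‖ : ℝ) = t := by field_simp
    rw [← hζt]
    have hn : ∀ u : ℝ, 0 ≤ u → ‖t / (‖t‖ : ℂ) * (u : ℂ)‖ = u := fun u hu => by
      rw [norm_mul, hζ1, one_mul, Complex.norm_of_nonneg hu]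
    refine norm_le_of_growth hP hT hg hode hR0 (hK' _ (hn R hR0.le).le) (fun u hu => ?_) h
    have hu0 : 0 ≤ u := hR0.le.trans hu
    have h1 := hRgrow (t / (‖t‖ : ℂ) * (u : ℂ)) (by rw [hn u hu0]; exact hu) (by
      rw [hn u hu0, mul_pow, div_pow, ← Complex.ofReal_pow, ← Complex.ofReal_pow,
        Complex.re_mul_ofReal, Complex.div_ofReal_re]
      have h2 : (t ^ d).re / ‖t‖ ^ d ≤ -1 / 2 := by
        rw [div_le_iff₀ (by positivity)]
        linarith
      nlinarith [pow_nonneg hu0 d])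
    rw [Complex.add_re]
    linarith [hs.1]
  refine ⟨1 + K, fun t => ?_⟩
  rcases eq_or_ne t 0 with rfl | ht
  · linarith [hK' 0 (by simpa using hR0.le)]
  obtain ⟨k, hk, z, hz, rfl⟩ := exists_eq_unityRoot_mul_exp hd ht
  refine norm_le_of_strip hd hg (by positivity) (by positivity) hexp (norm_unityRoot k)
    (unityRoot_pow hd k) (fun u hu => ?_) hreg hz
  rcases le_total u R with h | h
  · have : ‖unityRoot d k * (u : ℂ)‖ ≤ R := by
      rw [norm_mul, norm_unityRoot, one_mul, Complex.norm_of_nonneg hu]; exact h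
    linarith [hK' _ this]
  · have := norm_le_of_decay hP hT hg hode hR0 (fun v hv => by
      rw [Complex.add_re]
      linarith [hs.2, hRdec k v hv]) (hlim k hk) h
    linarith

end Polynomial

section Continuation

variable {d : ℕ} {a : ℕ → ℂ} {c : ℕ → ℂ} {s : ℂ}

/-- The function `u ↦ e^{P₀(ω_k u)}` on the ray through the root of unity `ω_k`. -/
noncomputable def rayExp (d : ℕ) (a : ℕ → ℂ) (k : ℕ) (u : ℝ) : ℂ :=
  Complex.exp (P0 d a (unityRoot d k * u))

/-- The entire function `s ↦ ∫_1^∞ u^{s-1} e^{P₀(ω_k u)} du`. -/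
noncomputable def omegaTail (d : ℕ) (a : ℕ → ℂ) (k : ℕ) (s : ℂ) : ℂ :=
  mellin ((Set.Ioi (1 : ℝ)).indicator (rayExp d a k)) s

lemma continuous_rayExp (k : ℕ) : Continuous (rayExp d a k) := by
  have := (differentiable_P0 (d := d) (a := a)).continuous
  unfold rayExp
  fun_prop

lemma rayExp_isBigO (hd : 1 ≤ d) (k : ℕ) (N : ℝ) :
    rayExp d a k =O[atTop] fun u : ℝ => u ^ (-N) := by
  obtain ⟨R, hR1, -, hR⟩ := exists_radius_eulerP0 (a := a) hd N
  have hderiv : ∀ u : ℝ, 0 < u → HasDerivAt _ _ u := fun u hu =>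
    hasDerivAt_norm_rayWeight (s := (N : ℂ)) (differentiable_P0 (d := d) (a := a))
      (mul_deriv_P0 hd) (unityRoot d k) hu
  have hanti : AntitoneOn (fun u => ‖rayWeight (P0 d a) N (unityRoot d k) u‖) (Set.Ici R) := by
    refine antitoneOn_of_deriv_nonpos (convex_Ici R)
      (fun u hu => (hderiv u (by linarith [Set.mem_Ici.1 hu])).continuousAt.continuousWithinAt)
      (fun u hu => ?_) (fun u hu => ?_)
    all_goals
      rw [interior_Ici, Set.mem_Ioi] at hu
      have hu0 : 0 < u := by linarith
    · exact (hderiv u hu0).differentiableAt.differentiableWithinAt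
    · rw [(hderiv u hu0).deriv, Complex.add_re, Complex.ofReal_re]
      exact mul_nonpos_of_nonneg_of_nonpos (by positivity) (by linarith [hR k u hu.le])
  refine Asymptotics.IsBigO.of_bound ‖rayWeight (P0 d a) N (unityRoot d k) R‖
    (eventually_atTop.2 ⟨R, fun u hu => ?_⟩)
  have hu0 : 0 < u := by linarith
  have h := hanti (Set.mem_Ici.2 le_rfl) (Set.mem_Ici.2 hu) hu
  have h2 : ‖rayWeight (P0 d a) N (unityRoot d k) u‖ = u ^ N * ‖rayExp d a k u‖ := by
    rw [rayWeight, rayExp, Complex.exp_add, norm_mul, ← Complex.ofReal_mul, ← Complex.ofReal_exp,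
      Complex.norm_of_nonneg (Real.exp_pos _).le, mul_comm N, ← Real.rpow_def_of_pos hu0]
  have h3 : u ^ (-N) * u ^ N = 1 := by
    rw [← Real.rpow_add hu0, neg_add_cancel, Real.rpow_zero]
  have h4 : 0 < u ^ (-N) := Real.rpow_pos_of_pos hu0 _
  simp only [h2] at h
  rw [Real.norm_of_nonneg h4.le]
  calc ‖rayExp d a k u‖ = (u ^ N * ‖rayExp d a k u‖) * u ^ (-N) := by
        linear_combination -‖rayExp d a k u‖ * h3
    _ ≤ _ := by gcongr

lemma mellinConvergent_rayExp (hd : 1 ≤ d) (k : ℕ) (hs : 0 < s.re) :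
    MellinConvergent (rayExp d a k) s := by
  refine mellinConvergent_of_isBigO_rpow (a := s.re + 1) (b := 0)
    ((continuous_rayExp k).locallyIntegrable.locallyIntegrableOn _) (rayExp_isBigO hd k _)
    (by linarith) ?_ hs
  simp only [neg_zero, Real.rpow_zero]
  exact ((continuous_rayExp k).tendsto 0).isBigO_one ℝ |>.mono nhdsWithin_le_nhds

lemma rayExp_indicator_isBigO_atTop (hd : 1 ≤ d) (k : ℕ) (N : ℝ) :
    (Set.Ioi (1 : ℝ)).indicator (rayExp d a k) =O[atTop] fun u : ℝ => u ^ (-N) :=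
  (rayExp_isBigO hd k N).congr' (by
    filter_upwards [eventually_gt_atTop (1 : ℝ)] with u hu
    rw [Set.indicator_of_mem (Set.mem_Ioi.2 hu)]) EventuallyEq.rfl

lemma rayExp_indicator_isBigO_zero (k : ℕ) (N : ℝ) :
    (Set.Ioi (1 : ℝ)).indicator (rayExp d a k) =O[𝓝[>] 0] fun u : ℝ => u ^ (-N) :=
  (Asymptotics.isBigO_zero _ _).congr' (by
    filter_upwards [nhdsWithin_le_nhds (Iio_mem_nhds (zero_lt_one' ℝ))] with u hu
    rw [Set.indicator_of_notMem (by simpa using (Set.mem_Iio.1 hu).le)]) EventuallyEq.rfl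

lemma locallyIntegrableOn_rayExp_indicator (k : ℕ) :
    LocallyIntegrableOn ((Set.Ioi (1 : ℝ)).indicator (rayExp d a k)) (Set.Ioi 0) :=
  ((continuous_rayExp k).locallyIntegrable.indicator measurableSet_Ioi).locallyIntegrableOn _

lemma differentiable_omegaTail (hd : 1 ≤ d) (k : ℕ) : Differentiable ℂ (omegaTail d a k) := fun s =>
  mellin_differentiableAt_of_isBigO_rpow (a := s.re + 1) (b := s.re - 1)
    (locallyIntegrableOn_rayExp_indicator k) (rayExp_indicator_isBigO_atTop hd k _) (by linarith)
    (rayExp_indicator_isBigO_zero k _) (by linarith)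

lemma integrableOn_rayExp (hd : 1 ≤ d) (k : ℕ) (s : ℂ) :
    IntegrableOn (fun u : ℝ => (u : ℂ) ^ (s - 1) * rayExp d a k u) (Set.Ioi 1) := by
  have h : MellinConvergent ((Set.Ioi (1 : ℝ)).indicator (rayExp d a k)) s :=
    mellinConvergent_of_isBigO_rpow (a := s.re + 1) (b := s.re - 1)
      (locallyIntegrableOn_rayExp_indicator k) (rayExp_indicator_isBigO_atTop hd k _)
      (by linarith) (rayExp_indicator_isBigO_zero k _) (by linarith)
  refine (h.mono_set (Set.Ioi_subset_Ioi zero_le_one)).congr_fun (fun u hu => ?_) measurableSet_Ioi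
  simp only [Set.indicator_of_mem hu, smul_eq_mul]

lemma omegaTail_eq (k : ℕ) (s : ℂ) :
    omegaTail d a k s = ∫ u in Set.Ioi (1 : ℝ), (u : ℂ) ^ (s - 1) * rayExp d a k u := by
  have h : ∀ u : ℝ, (u : ℂ) ^ (s - 1) • (Set.Ioi (1 : ℝ)).indicator (rayExp d a k) u
      = (Set.Ioi (1 : ℝ)).indicator (fun u : ℝ => (u : ℂ) ^ (s - 1) * rayExp d a k u) u := by
    intro u
    by_cases hu : u ∈ Set.Ioi (1 : ℝ) <;> simp [hu]
  rw [omegaTail, mellin]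
  simp only [h]
  rw [setIntegral_indicator measurableSet_Ioi,
    Set.inter_eq_right.2 (Set.Ioi_subset_Ioi zero_le_one)]

lemma hasDerivAt_cpow_mul_shiftedSeries
    (hc : ∀ t, HasSum (fun n => c n * t ^ n) (Complex.exp (P0 d a t)))
    (hs : s ∈ gammaDomain) (k : ℕ) {u : ℝ} (hu : 0 < u) :
    HasDerivAt (fun v : ℝ => (v : ℂ) ^ s * shiftedSeries c s (unityRoot d k * v))
      ((u : ℂ) ^ (s - 1) * rayExp d a k u) u := by
  have hc' : ∀ t, Summable fun n => c n * t ^ n := fun t => (hc t).summable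
  have hs0 : s ≠ 0 := by simpa using hs 0
  have hu' : (u : ℂ) ≠ 0 := by exact_mod_cast hu.ne'
  refine ((hasDerivAt_ofReal_cpow_const hu.ne' hs0).mul
    (hasDerivAt_comp_ray (shiftedSeries_differentiable hc' hs) (unityRoot d k) u)).congr_deriv ?_
  have hode := shiftedSeries_ode hc' hs (unityRoot d k * u)
  rw [(hc _).tsum_eq] at hode
  have hpow : (u : ℂ) ^ s = (u : ℂ) ^ (s - 1) * u := by
    rw [Complex.cpow_sub _ _ hu', Complex.cpow_one, div_mul_cancel₀ _ hu']
  rw [rayExp, ← hode, hpow]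
  ring

lemma tendsto_cpow_mul_shiftedSeries (hd : 1 ≤ d)
    (hc : ∀ t, HasSum (fun n => c n * t ^ n) (Complex.exp (P0 d a t)))
    (hs : s ∈ gammaDomain) (k : ℕ) :
    Tendsto (fun u : ℝ => (u : ℂ) ^ s * shiftedSeries c s (unityRoot d k * u)) atTop
      (𝓝 (shiftedSeries c s (unityRoot d k) + omegaTail d a k s)) := by
  have hint := integrableOn_rayExp (a := a) hd k s
  have h := (intervalIntegral_tendsto_integral_Ioi 1 hint tendsto_id).const_add
    (shiftedSeries c s (unityRoot d k))
  rw [← omegaTail_eq] at h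
  refine h.congr' ?_
  filter_upwards [eventually_ge_atTop (1 : ℝ)] with R hR
  rw [id, intervalIntegral.integral_eq_sub_of_hasDerivAt
    (fun u hu => hasDerivAt_cpow_mul_shiftedSeries hc hs k (by
      rw [Set.uIcc_of_le hR] at hu
      linarith [hu.1]))
    ((intervalIntegrable_iff_integrableOn_Ioc_of_le hR).2 (hint.mono_set Set.Ioc_subset_Ioi_self))]
  simp

lemma omegaFn_eq (hd : 1 ≤ d)
    (hc : ∀ t, HasSum (fun n => c n * t ^ n) (Complex.exp (P0 d a t)))
    (hsU : s ∈ gammaDomain) (hs : 0 < s.re) (k : ℕ) :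
    OmegaFn d a k s = Complex.exp (2 * Real.pi * Complex.I * k * s / d) *
      (shiftedSeries c s (unityRoot d k) + omegaTail d a k s) := by
  have hs0 : s ≠ 0 := by simpa using hsU 0
  have hdiff := shiftedSeries_differentiable (fun t => (hc t).summable) hsU
  have h := integral_Ioi_of_hasDerivAt_of_tendsto
    (f := fun v : ℝ => (v : ℂ) ^ s * shiftedSeries c s (unityRoot d k * v)) (a := 0)
    (Continuous.continuousWithinAt ((Complex.continuous_ofReal_cpow_const hs).mul
      (hdiff.continuous.comp (by fun_prop))))
    (fun u hu => hasDerivAt_cpow_mul_shiftedSeries hc hsU k hu)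
    (mellinConvergent_rayExp hd k hs) (tendsto_cpow_mul_shiftedSeries hd hc hsU k)
  rw [Complex.ofReal_zero, Complex.zero_cpow hs0, zero_mul, sub_zero] at h
  rw [OmegaFn, ← h]
  rfl

lemma continuation_eq (hd : 1 ≤ d)
    (hc : ∀ t, HasSum (fun n => c n * t ^ n) (Complex.exp (P0 d a t))) (k : ℕ) {f : ℂ → ℂ}
    (hf : DifferentiableOn ℂ f gammaDomain)
    (hfΩ : ∀ s : ℂ, 0 < s.re → f s = OmegaFn d a k s) (hs : s ∈ gammaDomain) :
    f s = Complex.exp (2 * Real.pi * Complex.I * k * s / d) *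
      (shiftedSeries c s (unityRoot d k) + omegaTail d a k s) := by
  have hone : (1 : ℂ) ∈ gammaDomain := fun n hn => by
    have := congrArg Complex.re hn
    simp only [Complex.one_re, Complex.neg_re, Complex.natCast_re] at this
    linarith [n.cast_nonneg (α := ℝ)]
  have hdiff : DifferentiableOn ℂ (fun s => Complex.exp (2 * Real.pi * Complex.I * k * s / d) *
      (shiftedSeries c s (unityRoot d k) + omegaTail d a k s)) gammaDomain :=
    (Differentiable.differentiableOn (by fun_prop)).mul
      ((differentiableOn_shiftedSeries_param (fun t => (hc t).summable) _).add
        (differentiable_omegaTail hd k).differentiableOn)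
  refine (hf.analyticOnNhd isOpen_gammaDomain).eqOn_of_preconnected_of_eventuallyEq
    (hdiff.analyticOnNhd isOpen_gammaDomain) isPreconnected_gammaDomain hone ?_ hs
  have hre : ∀ᶠ w : ℂ in 𝓝 1, 0 < w.re :=
    Complex.continuous_re.continuousAt.eventually (lt_mem_nhds (by simp))
  filter_upwards [hre, isOpen_gammaDomain.mem_nhds hone] with w hw hwU
  rw [hfΩ w hw, omegaFn_eq hd hc hwU hw]

end Continuation

lemma exists_hasSum_pow {f : ℂ → ℂ} (hf : Differentiable ℂ f) :
    ∃ c : ℕ → ℂ, ∀ t, HasSum (fun n => c n * t ^ n) (f t) := by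
  refine ⟨fun n => (n.factorial : ℂ)⁻¹ * iteratedDeriv n f 0, fun t => ?_⟩
  refine (Complex.hasSum_taylorSeries_of_entire hf 0 t).congr_fun fun n => ?_
  simp only [sub_zero, smul_eq_mul]
  ring

/-- The Omega functions have no common zero outside the nonpositive integers:
for `s₀ ∉ {0,-1,-2,…}`, the values `F_0(s₀), …, F_{d-1}(s₀)` are not all zero. -/
theorem stmt13 (d : ℕ) (hd : 1 ≤ d) (a : ℕ → ℂ) (F : ℕ → ℂ → ℂ)
    (hFdiff : ∀ k, k ≤ d - 1 →
      DifferentiableOn ℂ (F k) {s : ℂ | ∀ n : ℕ, s ≠ -(n : ℂ)})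
    (hFΩ : ∀ k, k ≤ d - 1 → ∀ s : ℂ, 0 < s.re → F k s = OmegaFn d a k s)
    (s₀ : ℂ) (hs₀ : ∀ n : ℕ, s₀ ≠ -(n : ℂ)) :
    ∃ k, k ≤ d - 1 ∧ F k s₀ ≠ 0 := by
  by_contra! hzero
  have hs : s₀ ∈ gammaDomain := hs₀
  have hs0 : s₀ ≠ 0 := by simpa using hs₀ 0
  have hP := differentiable_P0 (d := d) (a := a)
  obtain ⟨c, hc⟩ := exists_hasSum_pow hP.cexp
  have hc' : ∀ t, Summable fun n => c n * t ^ n := fun t => (hc t).summable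
  have hH := shiftedSeries_differentiable hc' hs
  set g : ℂ → ℂ := fun t => Complex.exp (-P0 d a t) * shiftedSeries c s₀ t with hg
  have hgdiff : Differentiable ℂ g := hP.neg.cexp.mul hH
  have hode : ∀ t, t * deriv g t + (s₀ + eulerP0 d a t) * g t = 1 := by
    intro t
    have hder := ((hP t).hasDerivAt.neg.cexp.mul (hH t).hasDerivAt).deriv
    have h := shiftedSeries_ode hc' hs t
    rw [(hc t).tsum_eq] at h
    have hexp : Complex.exp (-P0 d a t) * Complex.exp (P0 d a t) = 1 := by
      rw [← Complex.exp_add, neg_add_cancel, Complex.exp_zero]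
    have hder' : deriv g t = Complex.exp (-P0 d a t) * -deriv (P0 d a) t * shiftedSeries c s₀ t
      + Complex.exp (-P0 d a t) * deriv (shiftedSeries c s₀) t := hder
    rw [hder', ← mul_deriv_P0 hd, ← hexp, ← h, hg]
    ring
  have hlim : ∀ k ≤ d - 1, Tendsto
      (fun u : ℝ => rayWeight (P0 d a) s₀ (unityRoot d k) u * g (unityRoot d k * u))
      atTop (𝓝 0) := by
    intro k hk
    have h := continuation_eq hd hc k (hFdiff k hk) (hFΩ k hk) hs
    rw [hzero k hk, zero_eq_mul, or_iff_right (Complex.exp_ne_zero _)] at h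
    have ht := tendsto_cpow_mul_shiftedSeries hd hc hs k
    rw [h] at ht
    refine ht.congr' ?_
    filter_upwards [eventually_gt_atTop (0 : ℝ)] with u hu
    have hu' : (u : ℂ) ≠ 0 := by exact_mod_cast hu.ne'
    rw [rayWeight, hg, Complex.cpow_def_of_ne_zero hu', ← Complex.ofReal_log hu.le, ← mul_assoc,
      ← Complex.exp_add, add_neg_cancel_right, mul_comm s₀]
  obtain ⟨M, hM⟩ := exists_bound_of_ode hd hgdiff hode hlim
  have hconst : ∀ t, g t = g 0 := fun t => hgdiff.apply_eq_apply_of_bounded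
    (isBounded_iff_forall_norm_le.2 ⟨M, by rintro _ ⟨t, rfl⟩; exact hM t⟩) t 0
  have hderiv : ∀ t, deriv g t = 0 := fun t => by
    rw [funext hconst]
    simp
  have heuler : ∀ t, eulerP0 d a t = 0 := by
    intro t
    have h0 := hode 0
    have ht := hode t
    rw [← mul_deriv_P0 hd, hderiv] at h0
    rw [hderiv, hconst t] at ht
    have hg0 : g 0 ≠ 0 := by
      rintro h
      simp [h] at h0
    refine (mul_eq_zero.1 (?_ : eulerP0 d a t * g 0 = 0)).resolve_right hg0
    linear_combination ht - h0
  obtain ⟨R, -, -, hR⟩ := exists_radius_eulerP0 (a := a) hd 1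
  have h1 := hR 0 R le_rfl
  rw [heuler, Complex.zero_re] at h1
  linarith
end
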